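/- arXiv:2512.18150 — 2 statements merged into one kernel-verified Lean document; each statement's English description precedes it below -/
import Mathlib

section
/- Let U be a finite left X-set and V a finite left Y-set. For all u ∈ U and v ∈ V, the stabilizer in X*Y of the element u⊗v of U ⊗̂_{X,Y} V equals the composition of the stabilizers: (X*Y)_{u⊗v} = X_u * Y_v, where X_u ≤ G×H is the stabilizer of u in X and Y_v ≤ H×K is the stabilizer of v in Y. -/
namespace Ext

variable {G H K : Type*} [Group G] [Group H] [Group K]

/-- The composition `X * Y ≤ G × K` of subgroups `X ≤ G × H` and `Y ≤ H × K`. -/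
def comp (X : Subgroup (G × H)) (Y : Subgroup (H × K)) : Subgroup (G × K) where
  carrier := {p | ∃ h : H, (p.1, h) ∈ X ∧ (h, p.2) ∈ Y}
  one_mem' := ⟨1, X.one_mem, Y.one_mem⟩
  mul_mem' := by
    rintro ⟨g, k⟩ ⟨g', k'⟩ ⟨h, hX, hY⟩ ⟨h', hX', hY'⟩
    exact ⟨h * h', X.mul_mem hX hX', Y.mul_mem hY hY'⟩
  inv_mem' := by
    rintro ⟨g, k⟩ ⟨h, hX, hY⟩
    exact ⟨h⁻¹, X.inv_mem hX, Y.inv_mem hY⟩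

lemma mem_comp {X : Subgroup (G × H)} {Y : Subgroup (H × K)} {p : G × K} :
    p ∈ comp X Y ↔ ∃ h : H, (p.1, h) ∈ X ∧ (h, p.2) ∈ Y := Iff.rfl

/-- The set of linking elements `ℓ_{X,Y}(g,k)`. -/
def link (X : Subgroup (G × H)) (Y : Subgroup (H × K)) (g : G) (k : K) : Set H :=
  {h | (g, h) ∈ X ∧ (h, k) ∈ Y}

/-- The subgroup `k(X,Y) = k₂(X) ∩ k₁(Y)` of `H`. -/
def kSub (X : Subgroup (G × H)) (Y : Subgroup (H × K)) : Subgroup H where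
  carrier := {h | ((1 : G), h) ∈ X ∧ (h, (1 : K)) ∈ Y}
  one_mem' := ⟨X.one_mem, Y.one_mem⟩
  mul_mem' := by
    rintro a b ⟨haX, haY⟩ ⟨hbX, hbY⟩
    exact ⟨by simpa using X.mul_mem haX hbX, by simpa using Y.mul_mem haY hbY⟩
  inv_mem' := by
    rintro a ⟨haX, haY⟩
    exact ⟨by simpa using X.inv_mem haX, by simpa using Y.inv_mem haY⟩

/-- The embedding `k(X,Y) → X`, `h ↦ (1,h)`. -/
def ι₁ (X : Subgroup (G × H)) (Y : Subgroup (H × K)) : kSub X Y →* X where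
  toFun h := ⟨((1 : G), (h : H)), h.2.1⟩
  map_one' := rfl
  map_mul' a b := by
    ext : 1
    simp [Prod.ext_iff]

/-- The embedding `k(X,Y) → Y`, `h ↦ (h,1)`. -/
def ι₂ (X : Subgroup (G × H)) (Y : Subgroup (H × K)) : kSub X Y →* Y where
  toFun h := ⟨((h : H), (1 : K)), h.2.2⟩
  map_one' := rfl
  map_mul' a b := by
    ext : 1
    simp [Prod.ext_iff]

variable (X : Subgroup (G × H)) (Y : Subgroup (H × K))
variable (U V : Type*) [MulAction X U] [MulAction Y V]

/-- The setoid on `U × V` whose classes are the `k(X,Y)`-orbits. -/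
def etpSetoid : Setoid (U × V) where
  r p q := ∃ h : kSub X Y, (ι₁ X Y h • p.1, ι₂ X Y h • p.2) = q
  iseqv := by
    constructor
    · intro p
      exact ⟨1, by simp⟩
    · rintro p q ⟨h, rfl⟩
      exact ⟨h⁻¹, by simp [← mul_smul, ← map_mul]⟩
    · rintro p q r ⟨h, rfl⟩ ⟨h', rfl⟩
      exact ⟨h' * h, by simp [map_mul, mul_smul]⟩

/-- The extended tensor product of a left `X`-set `U` and a left `Y`-set `V`. -/
def ETP := Quotient (etpSetoid X Y U V)

/-- The elementary tensor `u ⊗ v`. -/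
def mk (p : U × V) : ETP X Y U V := Quotient.mk (etpSetoid X Y U V) p

variable {X Y U V}

lemma pair_rel {g : G} {k : K} {h h' : H} (hX : (g, h) ∈ X) (hY : (h, k) ∈ Y)
    (hX' : (g, h') ∈ X) (hY' : (h', k) ∈ Y) {p q : U × V}
    (hpq : (etpSetoid X Y U V).r p q) :
    (etpSetoid X Y U V).r
      ((⟨(g, h), hX⟩ : X) • p.1, (⟨(h, k), hY⟩ : Y) • p.2)
      ((⟨(g, h'), hX'⟩ : X) • q.1, (⟨(h', k), hY'⟩ : Y) • q.2) := by
  obtain ⟨m, rfl⟩ := hpq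
  have memX : ((1 : G), h' * (m : H) * h⁻¹) ∈ X := by
    simpa using X.mul_mem (X.mul_mem hX' m.2.1) (X.inv_mem hX)
  have memY : (h' * (m : H) * h⁻¹, (1 : K)) ∈ Y := by
    simpa using Y.mul_mem (Y.mul_mem hY' m.2.2) (Y.inv_mem hY)
  refine ⟨⟨h' * (m : H) * h⁻¹, memX, memY⟩, ?_⟩
  have e1 : ι₁ X Y ⟨h' * (m : H) * h⁻¹, memX, memY⟩ * (⟨(g, h), hX⟩ : X)
      = (⟨(g, h'), hX'⟩ : X) * ι₁ X Y m := by
    ext : 1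
    simp [ι₁, Prod.ext_iff, mul_assoc]
  have e2 : ι₂ X Y ⟨h' * (m : H) * h⁻¹, memX, memY⟩ * (⟨(h, k), hY⟩ : Y)
      = (⟨(h', k), hY'⟩ : Y) * ι₂ X Y m := by
    ext : 1
    simp [ι₂, Prod.ext_iff, mul_assoc]
  refine Prod.ext ?_ ?_
  · show ι₁ X Y _ • (⟨(g, h), hX⟩ : X) • p.1 = (⟨(g, h'), hX'⟩ : X) • ι₁ X Y m • p.1
    rw [← mul_smul, ← mul_smul, e1]
  · show ι₂ X Y _ • (⟨(h, k), hY⟩ : Y) • p.2 = (⟨(h', k), hY'⟩ : Y) • ι₂ X Y m • p.2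
    rw [← mul_smul, ← mul_smul, e2]

variable (X Y U V)

/-- A choice of linking element for `c ∈ X*Y`. -/
noncomputable def linkOf (c : comp X Y) : H := Classical.choose (mem_comp.mp c.2)

lemma linkOf_memX (c : comp X Y) : ((c : G × K).1, linkOf X Y c) ∈ X :=
  (Classical.choose_spec (mem_comp.mp c.2)).1

lemma linkOf_memY (c : comp X Y) : (linkOf X Y c, (c : G × K).2) ∈ Y :=
  (Classical.choose_spec (mem_comp.mp c.2)).2

noncomputable def xel (c : comp X Y) : X := ⟨((c : G × K).1, linkOf X Y c), linkOf_memX X Y c⟩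
noncomputable def yel (c : comp X Y) : Y := ⟨(linkOf X Y c, (c : G × K).2), linkOf_memY X Y c⟩

noncomputable instance : SMul (comp X Y) (ETP X Y U V) :=
  ⟨fun c => Quotient.map (fun p => (xel X Y c • p.1, yel X Y c • p.2))
    (fun _ _ hpq => pair_rel (linkOf_memX X Y c) (linkOf_memY X Y c)
      (linkOf_memX X Y c) (linkOf_memY X Y c) hpq)⟩

lemma smul_mk_def (c : comp X Y) (p : U × V) :
    c • mk X Y U V p = mk X Y U V (xel X Y c • p.1, yel X Y c • p.2) := rfl

/-- The action of `X*Y` on the extended tensor product, computed via any linking element. -/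
lemma smul_mk (c : comp X Y) (h : H) (hX : ((c : G × K).1, h) ∈ X)
    (hY : (h, (c : G × K).2) ∈ Y) (p : U × V) :
    c • mk X Y U V p
      = mk X Y U V ((⟨((c : G × K).1, h), hX⟩ : X) • p.1, (⟨(h, (c : G × K).2), hY⟩ : Y) • p.2) := by
  rw [smul_mk_def]
  exact Quotient.sound (pair_rel (linkOf_memX X Y c) (linkOf_memY X Y c) hX hY
    ((etpSetoid X Y U V).refl p))

noncomputable instance : MulAction (comp X Y) (ETP X Y U V) where
  one_smul q := by
    induction q using Quotient.inductionOn with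
    | h p =>
      have h1 : (((1 : comp X Y) : G × K).1, linkOf X Y 1) ∈ X := linkOf_memX X Y 1
      have hx : ((1 : G), linkOf X Y (1 : comp X Y)) ∈ X := h1
      have hy : (linkOf X Y (1 : comp X Y), (1 : K)) ∈ Y := linkOf_memY X Y 1
      refine Eq.trans (smul_mk X Y U V 1 (linkOf X Y 1) (linkOf_memX X Y 1) (linkOf_memY X Y 1) p) ?_
      refine (Quotient.sound ?_).symm
      exact ⟨⟨linkOf X Y (1 : comp X Y), hx, hy⟩, rfl⟩
  mul_smul c c' q := by
    induction q using Quotient.inductionOn with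
    | h p =>
      have hXc : (((c * c' : comp X Y) : G × K).1, linkOf X Y c * linkOf X Y c') ∈ X := by
        simpa using X.mul_mem (linkOf_memX X Y c) (linkOf_memX X Y c')
      have hYc : ((linkOf X Y c * linkOf X Y c', ((c * c' : comp X Y) : G × K).2)) ∈ Y := by
        simpa using Y.mul_mem (linkOf_memY X Y c) (linkOf_memY X Y c')
      show (c * c') • mk X Y U V p = c • (c' • mk X Y U V p)
      rw [smul_mk X Y U V (c * c') (linkOf X Y c * linkOf X Y c') hXc hYc p]
      rw [smul_mk_def, smul_mk_def]
      congr 1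
      refine Prod.ext ?_ ?_
      · show (⟨_, hXc⟩ : X) • p.1 = xel X Y c • xel X Y c' • p.1
        rw [← mul_smul]
        congr 1
      · show (⟨_, hYc⟩ : Y) • p.2 = yel X Y c • yel X Y c' • p.2
        rw [← mul_smul]
        congr 1

end Ext

open Ext in
/-- the stabilizer in `X*Y` of the elementary tensor `u ⊗ v ∈ U ⊗̂_{X,Y} V`
equals the composition `X_u * Y_v` of the point stabilizers (all viewed as subgroups of
`G × K`, resp. `G × H` and `H × K`). -/
theorem stmt2 {G H K : Type*} [Group G] [Group H] [Group K]
    [Finite G] [Finite H] [Finite K]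
    (X : Subgroup (G × H)) (Y : Subgroup (H × K))
    (U V : Type*) [MulAction X U] [MulAction Y V] [Finite U] [Finite V]
    (u : U) (v : V) :
    Subgroup.map (comp X Y).subtype
        (MulAction.stabilizer (comp X Y) (mk X Y U V (u, v)))
      = comp (Subgroup.map X.subtype (MulAction.stabilizer X u))
          (Subgroup.map Y.subtype (MulAction.stabilizer Y v)) := by
  ext p
  constructor
  · rintro ⟨c, hc, rfl⟩
    have hc' : mk X Y U V (xel X Y c • u, yel X Y c • v) = mk X Y U V (u, v) := hc
    obtain ⟨m, hm⟩ := Quotient.exact hc'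
    obtain ⟨hu, hv⟩ := Prod.ext_iff.mp hm
    refine mem_comp.mpr ⟨m * linkOf X Y c,
      ⟨ι₁ X Y m * xel X Y c, (mul_smul _ _ _).trans hu, ?_⟩,
      ⟨ι₂ X Y m * yel X Y c, (mul_smul _ _ _).trans hv, ?_⟩⟩
    · simp [ι₁, xel]
    · simp [ι₂, yel]
  · rintro ⟨h, ⟨⟨_, hX⟩, hu, rfl⟩, ⟨⟨_, hY⟩, hv, rfl⟩⟩
    refine ⟨⟨p, h, hX, hY⟩, ?_, rfl⟩
    exact (smul_mk X Y U V ⟨p, h, hX, hY⟩ h hX hY (u, v)).trans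
      (congrArg (mk X Y U V) (Prod.ext hu hv))
end

section
/- Let U be a finite left X-set and V a finite left Y-set. For (g,k) ∈ X*Y, the value (g,h)u ⊗ (h,k)v in U ⊗̂_{X,Y} V is independent of the choice of linking element h ∈ ℓ_{X,Y}(g,k) and of the representative (u,v) of the k(X,Y)-orbit u⊗v, and the resulting rule (g,k)·(u⊗v) = (g,h)u ⊗ (h,k)v defines a left action of the group X*Y on the set U ⊗̂_{X,Y} V. -/
open Ext in
/-- STATEMENT 15: the rule `(g,k)·(u⊗v) = (g,h)u ⊗ (h,k)v` is independent of the choice of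
linking element `h ∈ ℓ_{X,Y}(g,k)` and of the representative `(u,v)`, and defines a left
action of `X*Y` on `U ⊗̂_{X,Y} V`. -/
theorem stmt15 {G H K : Type*} [Group G] [Group H] [Group K]
    [Finite G] [Finite H] [Finite K]
    (X : Subgroup (G × H)) (Y : Subgroup (H × K))
    (U V : Type*) [MulAction X U] [MulAction Y V] [Finite U] [Finite V] :
    ∃ act : comp X Y → ETP X Y U V → ETP X Y U V,
      (∀ (c : comp X Y) (h : H) (hX : ((c : G × K).1, h) ∈ X) (hY : (h, (c : G × K).2) ∈ Y)
        (p : U × V),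
        act c (mk X Y U V p)
          = mk X Y U V ((⟨((c : G × K).1, h), hX⟩ : X) • p.1,
              (⟨(h, (c : G × K).2), hY⟩ : Y) • p.2))
      ∧ (∀ q : ETP X Y U V, act 1 q = q)
      ∧ (∀ (c c' : comp X Y) (q : ETP X Y U V), act (c * c') q = act c (act c' q)) := by
  exact ⟨fun c q => c • q, smul_mk X Y U V, one_smul _, mul_smul⟩
end
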